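/- arXiv:math-ph/0611014 — 3 statements merged into one kernel-verified Lean document; each statement's English description precedes it below -/
import Mathlib

section
/- Let δ be a finite-dimensional complex Lie algebra with a symmetric invariant bilinear form B (i.e., B([x,y],z) + B(y,[x,z]) = 0). For every positive integer k and all integers m, n, the function ψ^k_{m,n} on the loop algebra Lδ is infinitesimally invariant under the adjoint action: for all L, M ∈ Lδ, the function t ↦ ψ^k_{m,n}(L + t[M,L]) (t ∈ ℂ) has derivative 0 at t = 0. -/
/-- The bracket on the loop algebra `Lδ`: `[L,L']_k = Σ_{i+j=k} [L_i, L'_j]`. -/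
noncomputable def loopBracket {δ : Type*} [LieRing δ] [LieAlgebra ℂ δ]
    (L L' : ℤ →₀ δ) : ℤ →₀ δ :=
  L.sum fun i x => L'.sum fun j y => Finsupp.single (i + j) ⁅x, y⁆

/-- For `L ∈ Lδ`, the Laurent polynomial `Q_L` (an element of the group algebra
`ℂ[λ,λ⁻¹] = AddMonoidAlgebra ℂ ℤ`) whose coefficient at `λ^d` is
`Σ_{i+j=d} B(L_i, L_j)`. -/
noncomputable def qpoly {δ : Type*} [AddCommGroup δ] [Module ℂ δ]
    (B : δ →ₗ[ℂ] δ →ₗ[ℂ] ℂ) (L : ℤ →₀ δ) : AddMonoidAlgebra ℂ ℤ :=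
  L.sum fun i x => L.sum fun j y => AddMonoidAlgebra.single (i + j) (B x y)

/-- The `ℂ[λ,λ⁻¹]`-valued bilinear form on the loop algebra whose quadratic form is `qpoly B`. -/
noncomputable def loopForm {δ : Type*} [AddCommGroup δ] [Module ℂ δ]
    (B : δ →ₗ[ℂ] δ →ₗ[ℂ] ℂ) : (ℤ →₀ δ) →ₗ[ℂ] (ℤ →₀ δ) →ₗ[ℂ] AddMonoidAlgebra ℂ ℤ :=
  Finsupp.lsum ℂ fun i => LinearMap.flip <| Finsupp.lsum ℂ fun j =>
    (B.compr₂ (AddMonoidAlgebra.lsingle (i + j))).flip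

theorem loopForm_single {δ : Type*} [AddCommGroup δ] [Module ℂ δ]
    (B : δ →ₗ[ℂ] δ →ₗ[ℂ] ℂ) (i j : ℤ) (x y : δ) :
    loopForm B (Finsupp.single i x) (Finsupp.single j y) =
      AddMonoidAlgebra.single (i + j) (B x y) := by
  simp [loopForm]

theorem qpoly_eq_loopForm {δ : Type*} [AddCommGroup δ] [Module ℂ δ]
    (B : δ →ₗ[ℂ] δ →ₗ[ℂ] ℂ) (L : ℤ →₀ δ) : qpoly B L = loopForm B L L := by
  simp [qpoly, loopForm, Finsupp.lsum_apply, Finsupp.sum, LinearMap.sum_apply]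

theorem loopForm_symm {δ : Type*} [AddCommGroup δ] [Module ℂ δ]
    (B : δ →ₗ[ℂ] δ →ₗ[ℂ] ℂ) (hBsymm : ∀ x y : δ, B x y = B y x) (L L' : ℤ →₀ δ) :
    loopForm B L L' = loopForm B L' L := by
  induction L using Finsupp.induction_linear with
  | zero => simp
  | add f g hf hg => simp [hf, hg]
  | single i x =>
    induction L' using Finsupp.induction_linear with
    | zero => simp
    | add f g hf hg => simp [hf, hg]
    | single j y => rw [loopForm_single, loopForm_single, hBsymm, add_comm]

theorem loopBracket_single {δ : Type*} [LieRing δ] [LieAlgebra ℂ δ] (i j : ℤ) (x y : δ) :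
    loopBracket (Finsupp.single i x) (Finsupp.single j y) = Finsupp.single (i + j) ⁅x, y⁆ := by
  simp [loopBracket]

theorem zero_loopBracket {δ : Type*} [LieRing δ] [LieAlgebra ℂ δ] (L : ℤ →₀ δ) :
    loopBracket 0 L = 0 := by
  simp [loopBracket]

theorem loopBracket_zero {δ : Type*} [LieRing δ] [LieAlgebra ℂ δ] (L : ℤ →₀ δ) :
    loopBracket L 0 = 0 := by
  simp [loopBracket]

theorem add_loopBracket {δ : Type*} [LieRing δ] [LieAlgebra ℂ δ] (L L' N : ℤ →₀ δ) :
    loopBracket (L + L') N = loopBracket L N + loopBracket L' N := by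
  unfold loopBracket
  exact Finsupp.sum_add_index' (by simp) fun i x y => by
    simp only [add_lie, Finsupp.single_add, Finsupp.sum_add]

theorem loopBracket_add {δ : Type*} [LieRing δ] [LieAlgebra ℂ δ] (N L L' : ℤ →₀ δ) :
    loopBracket N (L + L') = loopBracket N L + loopBracket N L' := by
  unfold loopBracket
  rw [← Finsupp.sum_add]
  refine Finsupp.sum_congr fun i _ => ?_
  exact Finsupp.sum_add_index' (by simp) fun j x y => by simp

theorem loopForm_invariant {δ : Type*} [LieRing δ] [LieAlgebra ℂ δ]
    (B : δ →ₗ[ℂ] δ →ₗ[ℂ] ℂ) (hBinv : ∀ x y z : δ, B ⁅x, y⁆ z + B y ⁅x, z⁆ = 0)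
    (M L L' : ℤ →₀ δ) :
    loopForm B (loopBracket M L) L' + loopForm B L (loopBracket M L') = 0 := by
  induction M using Finsupp.induction_linear with
  | zero => simp [zero_loopBracket]
  | add f g hf hg =>
    simp only [add_loopBracket, map_add, LinearMap.add_apply]
    rw [add_add_add_comm, hf, hg, add_zero]
  | single i x =>
    induction L using Finsupp.induction_linear with
    | zero => simp [loopBracket_zero]
    | add f g hf hg =>
      simp only [loopBracket_add, map_add, LinearMap.add_apply]
      rw [add_add_add_comm, hf, hg, add_zero]
    | single j y =>
      induction L' using Finsupp.induction_linear with
      | zero => simp [loopBracket_zero]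
      | add f g hf hg =>
        simp only [loopBracket_add, map_add]
        rw [add_add_add_comm, hf, hg, add_zero]
      | single l z =>
        rw [loopBracket_single, loopBracket_single, loopForm_single, loopForm_single,
          add_left_comm j i l, ← add_assoc i j l, ← AddMonoidAlgebra.single_add, hBinv,
          AddMonoidAlgebra.single_zero]

theorem qpoly_add_smul_loopBracket {δ : Type*} [LieRing δ] [LieAlgebra ℂ δ]
    (B : δ →ₗ[ℂ] δ →ₗ[ℂ] ℂ) (hBsymm : ∀ x y : δ, B x y = B y x)
    (hBinv : ∀ x y z : δ, B ⁅x, y⁆ z + B y ⁅x, z⁆ = 0) (L M : ℤ →₀ δ) (t : ℂ) :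
    qpoly B (L + t • loopBracket M L) = t ^ 2 • qpoly B (loopBracket M L) + qpoly B L := by
  have h := loopForm_invariant B hBinv M L L
  rw [loopForm_symm B hBsymm L] at h
  have h0 : loopForm B (loopBracket M L) L = 0 := by
    rw [← two_smul ℂ] at h
    exact (smul_eq_zero.mp h).resolve_left two_ne_zero
  simp only [qpoly_eq_loopForm, map_add, map_smul, LinearMap.add_apply, LinearMap.smul_apply,
    loopForm_symm B hBsymm L (loopBracket M L), h0, smul_zero, sq]
  simp [add_comm, mul_smul]

theorem hasDerivAt_coeff_sq_smul_add_pow (P Q : AddMonoidAlgebra ℂ ℤ) (k : ℕ) (d : ℤ) :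
    HasDerivAt (fun t : ℂ => ((t ^ 2 • P + Q) ^ k).coeff d) 0 0 := by
  have h : ∀ t : ℂ, ((t ^ 2 • P + Q) ^ k).coeff d =
      ∑ i ∈ Finset.range (k + 1), (t ^ 2) ^ i * (P ^ i * Q ^ (k - i) * (k.choose i : ℕ)).coeff d := by
    intro t
    simp only [add_pow, smul_pow, smul_mul_assoc, AddMonoidAlgebra.coeff_sum,
      Finsupp.finsetSum_apply, AddMonoidAlgebra.coeff_smul, Finsupp.smul_apply, smul_eq_mul]
  simp only [h]
  have hsq : HasDerivAt (fun t : ℂ => t ^ 2) 0 0 := by simpa using hasDerivAt_pow 2 (0 : ℂ)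
  simpa using HasDerivAt.fun_sum (u := Finset.range (k + 1)) fun i _ =>
    (hsq.fun_pow i).mul_const ((P ^ i * Q ^ (k - i) * (k.choose i : ℕ)).coeff d)

/-- For a symmetric invariant bilinear form `B` on `δ`, the functions
`ψ^k_{m,n}(L)` (the coefficient of `λ^{n-1-2mk}` in `Q_L^k`) on the loop
algebra `Lδ` are infinitesimally invariant under the adjoint action:
`t ↦ ψ^k_{m,n}(L + t[M,L])` has derivative `0` at `t = 0`. -/
theorem statement6 (δ : Type*) [LieRing δ] [LieAlgebra ℂ δ]
    [FiniteDimensional ℂ δ]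
    (B : δ →ₗ[ℂ] δ →ₗ[ℂ] ℂ)
    (hBsymm : ∀ x y : δ, B x y = B y x)
    (hBinv : ∀ x y z : δ, B ⁅x, y⁆ z + B y ⁅x, z⁆ = 0)
    (k : ℕ) (hk : 0 < k) (m n : ℤ) (L M : ℤ →₀ δ) :
    HasDerivAt
      (fun t : ℂ =>
        ((qpoly B (L + t • loopBracket M L)) ^ k).coeff (n - 1 - 2 * m * (k : ℤ)))
      0 0 := by
  simp only [qpoly_add_smul_loopBracket B hBsymm hBinv]
  exact hasDerivAt_coeff_sq_smul_add_pow _ _ k _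
end

section
/- Let g₀ be the 6-dimensional complex Lie algebra with basis Y₁, Y₂, Y₃, Y₄, Y₅, Z₀ whose only nonzero brackets of basis vectors are [Y₁,Y₂] = 2Y₄ = −[Y₂,Y₁], [Z₀,Y₁] = Y₁, [Z₀,Y₂] = 2Y₂, [Z₀,Y₃] = 3Y₃, [Z₀,Y₄] = 3Y₄, [Z₀,Y₅] = 4Y₅ (and the brackets obtained by antisymmetry). Let δ = g₀ ⊕ g₀* be the double Lie algebra with bracket [(X,α),(Y,β)] = ([X,Y], ad*_X β − ad*_Y α), where (ad*_X β)(Z) = −β([X,Z]). Then the center of the 12-dimensional Lie algebra δ is exactly the span of (0, Z₀*), where Z₀* is the element of the dual basis of g₀* dual to Z₀; that is, (X,α) ∈ δ satisfies [(X,α),(Y,β)] = 0 for all (Y,β) ∈ δ if and only if X = 0 and α ∈ ℂ·Z₀*. -/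
/-- The coadjoint action `ad*_X β`, defined by `(ad*_X β)(Z) = -β([X,Z])`. -/
def coad {g : Type*} [LieRing g] [LieAlgebra ℂ g] (X : g)
    (β : Module.Dual ℂ g) : Module.Dual ℂ g :=
  -(β ∘ₗ (LieAlgebra.ad ℂ g X))

/-- The bracket on the double `δ = g ⊕ g*`:
`[(X,α),(Y,β)] = ([X,Y], ad*_X β − ad*_Y α)`. -/
def doubleBracket {g : Type*} [LieRing g] [LieAlgebra ℂ g]
    (u v : g × Module.Dual ℂ g) : g × Module.Dual ℂ g :=
  (⁅u.1, v.1⁆, coad u.1 v.2 - coad v.1 u.2)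

/-- `(X, α)` is central in the double of `g` iff `X` is central in `g` and `α` kills all brackets. -/
theorem forall_doubleBracket_eq_zero_iff {g : Type*} [LieRing g] [LieAlgebra ℂ g]
    (X : g) (α : Module.Dual ℂ g) :
    (∀ (Y : g) (β : Module.Dual ℂ g), doubleBracket (X, α) (Y, β) = 0) ↔
      (∀ Y : g, ⁅X, Y⁆ = 0) ∧ ∀ Y Z : g, α ⁅Y, Z⁆ = 0 := by
  constructor
  · intro h
    refine ⟨fun Y ↦ congrArg Prod.fst (h Y 0), fun Y Z ↦ ?_⟩
    simpa [doubleBracket, coad] using LinearMap.congr_fun (congrArg Prod.snd (h Y 0)) Z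
  · rintro ⟨hX, hα⟩ Y β
    refine Prod.ext (hX Y) (LinearMap.ext fun Z ↦ ?_)
    simp [doubleBracket, coad, hX, hα]

/-- Let `g₀` be the 6-dimensional complex Lie algebra with basis
`Y₁,…,Y₅,Z₀` (here `b 0,…,b 4, b 5`) whose only nonzero brackets of basis
vectors are `[Y₁,Y₂] = 2Y₄`, `[Z₀,Y₁] = Y₁`, `[Z₀,Y₂] = 2Y₂`, `[Z₀,Y₃] = 3Y₃`,
`[Z₀,Y₄] = 3Y₄`, `[Z₀,Y₅] = 4Y₅` (and those given by antisymmetry).  Then the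
center of the double Lie algebra `δ = g₀ ⊕ g₀*` is exactly the span of
`(0, Z₀*)`, where `Z₀*` is the dual-basis functional `b.coord 5`. -/
theorem statement18 (g₀ : Type*) [LieRing g₀] [LieAlgebra ℂ g₀]
    (b : Module.Basis (Fin 6) ℂ g₀)
    (h12 : ⁅b 0, b 1⁆ = (2 : ℂ) • b 3)
    (hYY : ∀ i j : Fin 6, (i : ℕ) < 5 → (j : ℕ) < 5 →
        ¬(i = 0 ∧ j = 1) → ¬(i = 1 ∧ j = 0) → ⁅b i, b j⁆ = 0)
    (hZ1 : ⁅b 5, b 0⁆ = b 0)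
    (hZ2 : ⁅b 5, b 1⁆ = (2 : ℂ) • b 1)
    (hZ3 : ⁅b 5, b 2⁆ = (3 : ℂ) • b 2)
    (hZ4 : ⁅b 5, b 3⁆ = (3 : ℂ) • b 3)
    (hZ5 : ⁅b 5, b 4⁆ = (4 : ℂ) • b 4) :
    ∀ (X : g₀) (α : Module.Dual ℂ g₀),
      (∀ (Y : g₀) (β : Module.Dual ℂ g₀), doubleBracket (X, α) (Y, β) = 0)
        ↔ (X = 0 ∧ ∃ c : ℂ, α = c • b.coord 5) := by
  intro X α
  rw [forall_doubleBracket_eq_zero_iff]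
  have skew (i j : Fin 6) : ⁅b i, b j⁆ = -⁅b j, b i⁆ := (lie_skew _ _).symm
  constructor
  · rintro ⟨hX, hα⟩
    have hsum := b.sum_repr X
    rw [Fin.sum_univ_six] at hsum
    have hZ : ⁅b 5, X⁆ = 0 := by rw [← lie_skew, hX, neg_zero]
    rw [← hsum] at hZ
    simp only [lie_add, lie_smul, hZ1, hZ2, hZ3, hZ4, hZ5, lie_self] at hZ
    have hcoord (i : Fin 6) := congrArg (fun v ↦ b.repr v i) hZ
    have x0 : b.repr X 0 = 0 := by simpa using hcoord 0
    have x1 : b.repr X 1 = 0 := by simpa using hcoord 1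
    have x2 : b.repr X 2 = 0 := by simpa using hcoord 2
    have x3 : b.repr X 3 = 0 := by simpa using hcoord 3
    have x4 : b.repr X 4 = 0 := by simpa using hcoord 4
    simp only [x0, x1, x2, x3, x4, zero_smul, zero_add] at hsum
    have hY := hX (b 0)
    rw [← hsum, smul_lie, hZ1] at hY
    have x5 : b.repr X 5 = 0 := (smul_eq_zero.mp hY).resolve_right (b.ne_zero 0)
    refine ⟨by rw [← hsum, x5, zero_smul], α (b 5), b.ext fun i ↦ ?_⟩
    have a0 := hα (b 5) (b 0)
    have a1 := hα (b 5) (b 1)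
    have a2 := hα (b 5) (b 2)
    have a3 := hα (b 5) (b 3)
    have a4 := hα (b 5) (b 4)
    simp only [hZ1, hZ2, hZ3, hZ4, hZ5, map_smul, smul_eq_mul, mul_eq_zero, OfNat.ofNat_ne_zero,
      false_or] at a0 a1 a2 a3 a4
    fin_cases i <;> simp [a0, a1, a2, a3, a4]
  · rintro ⟨rfl, c, rfl⟩
    refine ⟨fun Y ↦ zero_lie Y, fun Y Z ↦ ?_⟩
    have hZ (j : Fin 6) : b.coord 5 ⁅b 5, b j⁆ = 0 := by
      fin_cases j <;> simp [hZ1, hZ2, hZ3, hZ4, hZ5]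
    have hb (i j : Fin 6) : b.coord 5 ⁅b i, b j⁆ = 0 := by
      by_cases hi : i = 5
      · rw [hi, hZ]
      by_cases hj : j = 5
      · rw [hj, skew, map_neg, hZ, neg_zero]
      by_cases h01 : i = 0 ∧ j = 1
      · simp [h01.1, h01.2, h12]
      by_cases h10 : i = 1 ∧ j = 0
      · simp [h10.1, h10.2, skew 1 0, h12]
      rw [hYY i j (by omega) (by omega) h01 h10, map_zero]
    have hzero : (LieAlgebra.ad ℂ g₀ : g₀ →ₗ[ℂ] Module.End ℂ g₀).compr₂ (b.coord 5) = 0 :=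
      b.ext fun i ↦ b.ext fun j ↦ hb i j
    have hYZ : b.coord 5 ⁅Y, Z⁆ = 0 := LinearMap.congr_fun₂ hzero Y Z
    rw [LinearMap.smul_apply, hYZ, smul_zero]
end

section
/- Let g₀ be the 6-dimensional complex Lie algebra with basis Y₁, Y₂, Y₃, Y₄, Y₅, Z₀ whose only nonzero brackets of basis vectors are [Y₁,Y₂] = 2Y₄ = −[Y₂,Y₁], [Z₀,Y₁] = Y₁, [Z₀,Y₂] = 2Y₂, [Z₀,Y₃] = 3Y₃, [Z₀,Y₄] = 3Y₄, [Z₀,Y₅] = 4Y₅, and let δ = g₀ ⊕ g₀* be the double Lie algebra with bracket [(X,α),(Y,β)] = ([X,Y], ad*_X β − ad*_Y α). For a ∈ δ, write a₆ for the coefficient of Z₀ in the g₀-component of a, and let ad_δ(a) : δ → δ be the adjoint operator. Then for every odd positive integer k, Tr(ad_δ(a)^k) = 0 for all a ∈ δ; and for every even positive integer k there exists a constant C_k ∈ ℂ, independent of a, such that Tr(ad_δ(a)^k) = C_k · a₆^k for all a ∈ δ. -/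
/-- The adjoint operator `ad_δ(a) : δ → δ`, `ad_δ(a)(v) = [a,v]`, of the double
Lie algebra `δ = g ⊕ g*` with bracket
`[(X,α),(Y,β)] = ([X,Y], ad*_X β − ad*_Y α)`, as a linear endomorphism. -/
def adDouble {g : Type*} [LieRing g] [LieAlgebra ℂ g]
    (a : g × Module.Dual ℂ g) :
    (g × Module.Dual ℂ g) →ₗ[ℂ] (g × Module.Dual ℂ g) where
  toFun v := (⁅a.1, v.1⁆, coad a.1 v.2 - coad v.1 a.2)
  map_add' v w := by
    ext z
    · simp
    · simp [coad, LinearMap.comp_apply]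
      ring
  map_smul' c v := by
    ext z
    · simp
    · simp [coad, LinearMap.comp_apply]

/-- The diagonal of a product of matrices that are triangular for an injective labelling. -/
theorem blockTriangular_mul_apply_self {n α R : Type*} [Fintype n] [LinearOrder α]
    [Semiring R] {M N : Matrix n n R} {f : n → α} (hf : Function.Injective f)
    (hM : M.BlockTriangular f) (hN : N.BlockTriangular f) (i : n) :
    (M * N) i i = M i i * N i i := by
  rw [Matrix.mul_apply]
  refine Finset.sum_eq_single i (fun j _ hji => ?_) (fun h => absurd (Finset.mem_univ i) h)
  rcases lt_or_gt_of_ne (hf.ne hji) with h | h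
  · rw [hM h, zero_mul]
  · rw [hN h, mul_zero]

theorem blockTriangular_pow_apply_self {n α R : Type*} [Fintype n] [DecidableEq n]
    [LinearOrder α] [CommRing R] {M : Matrix n n R} {f : n → α} (hf : Function.Injective f)
    (hM : M.BlockTriangular f) (k : ℕ) :
    (M ^ k).BlockTriangular f ∧ ∀ i, (M ^ k) i i = M i i ^ k := by
  induction k with
  | zero => exact ⟨by simpa using Matrix.blockTriangular_one, by simp⟩
  | succ k ih =>
    refine ⟨by rw [pow_succ]; exact ih.1.mul hM, fun i => ?_⟩
    rw [pow_succ, blockTriangular_mul_apply_self hf ih.1 hM, ih.2, pow_succ]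

theorem exists_adDouble_pow_eq {g : Type*} [LieRing g] [LieAlgebra ℂ g] (a : g × Module.Dual ℂ g)
    (k : ℕ) : ∃ R : g →ₗ[ℂ] Module.Dual ℂ g, (adDouble a) ^ k =
      ((LieAlgebra.ad ℂ g a.1) ^ k).prodMap
        ((-1 : ℂ) ^ k • Module.Dual.transpose ((LieAlgebra.ad ℂ g a.1) ^ k)) +
      LinearMap.inr ℂ g (Module.Dual ℂ g) ∘ₗ R ∘ₗ LinearMap.fst ℂ g (Module.Dual ℂ g) := by
  induction k with
  | zero =>
    refine ⟨0, ?_⟩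
    ext v <;> simp [Module.Dual.transpose]
  | succ k ih =>
    obtain ⟨R, hR⟩ := ih
    refine ⟨R ∘ₗ LieAlgebra.ad ℂ g a.1 + ((-1 : ℂ) ^ k •
      Module.Dual.transpose ((LieAlgebra.ad ℂ g a.1) ^ k)) ∘ₗ
        (LinearMap.snd ℂ _ _ ∘ₗ adDouble a ∘ₗ LinearMap.inl ℂ _ _), ?_⟩
    rw [pow_succ, hR]
    refine LinearMap.ext fun v => Prod.ext ?_ (LinearMap.ext fun z => ?_)
    · simp [adDouble, pow_succ]
    · simp [adDouble, coad, Module.Dual.transpose_apply, pow_succ']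
      ring

/-- Traces of powers of the adjoint operator of the double. -/
theorem trace_adDouble_pow {g : Type*} [LieRing g] [LieAlgebra ℂ g] [FiniteDimensional ℂ g]
    (a : g × Module.Dual ℂ g) (k : ℕ) :
    LinearMap.trace ℂ _ ((adDouble a) ^ k) =
      (1 + (-1) ^ k) * LinearMap.trace ℂ g ((LieAlgebra.ad ℂ g a.1) ^ k) := by
  obtain ⟨R, hR⟩ := exists_adDouble_pow_eq a k
  have h0 : LinearMap.trace ℂ (g × Module.Dual ℂ g)
      (LinearMap.inr ℂ g (Module.Dual ℂ g) ∘ₗ R ∘ₗ LinearMap.fst ℂ g (Module.Dual ℂ g)) = 0 := by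
    rw [LinearMap.trace_comp_comm', LinearMap.comp_assoc, LinearMap.fst_comp_inr]
    simp
  rw [hR, map_add, h0, LinearMap.trace_prodMap', map_smul, LinearMap.trace_transpose',
    smul_eq_mul]
  ring


/-- For the 6-dimensional Lie algebra `g₀` of the worked example (basis
`Y₁,…,Y₅,Z₀ = b 0,…,b 5`) and its double `δ = g₀ ⊕ g₀*`, writing `a₆` for the
coefficient of `Z₀` in the `g₀`-component of `a ∈ δ`:  for every odd positive
`k`, `Tr(ad_δ(a)^k) = 0`;  and for every even positive `k` there is a constant
`C_k` with `Tr(ad_δ(a)^k) = C_k · a₆^k` for all `a`. -/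
theorem statement19 (g₀ : Type*) [LieRing g₀] [LieAlgebra ℂ g₀]
    [FiniteDimensional ℂ g₀]
    (b : Module.Basis (Fin 6) ℂ g₀)
    (h12 : ⁅b 0, b 1⁆ = (2 : ℂ) • b 3)
    (hYY : ∀ i j : Fin 6, (i : ℕ) < 5 → (j : ℕ) < 5 →
        ¬(i = 0 ∧ j = 1) → ¬(i = 1 ∧ j = 0) → ⁅b i, b j⁆ = 0)
    (hZ1 : ⁅b 5, b 0⁆ = b 0)
    (hZ2 : ⁅b 5, b 1⁆ = (2 : ℂ) • b 1)
    (hZ3 : ⁅b 5, b 2⁆ = (3 : ℂ) • b 2)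
    (hZ4 : ⁅b 5, b 3⁆ = (3 : ℂ) • b 3)
    (hZ5 : ⁅b 5, b 4⁆ = (4 : ℂ) • b 4) :
    (∀ k : ℕ, Odd k → 0 < k → ∀ a : g₀ × Module.Dual ℂ g₀,
        LinearMap.trace ℂ (g₀ × Module.Dual ℂ g₀) ((adDouble a) ^ k) = 0) ∧
    (∀ k : ℕ, Even k → 0 < k → ∃ C : ℂ, ∀ a : g₀ × Module.Dual ℂ g₀,
        LinearMap.trace ℂ (g₀ × Module.Dual ℂ g₀) ((adDouble a) ^ k)
          = C * (b.repr a.1 5) ^ k) := by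
  have hskew (i j : Fin 6) : ⁅b i, b j⁆ = -⁅b j, b i⁆ := (lie_skew _ _).symm
  have htr (X : g₀) (k : ℕ) (hk : 0 < k) :
      LinearMap.trace ℂ g₀ ((LieAlgebra.ad ℂ g₀ X) ^ k)
        = (1 + 2 ^ k + 3 ^ k + 3 ^ k + 4 ^ k) * (b.repr X 5) ^ k := by
    have hX (j : Fin 6) : ⁅X, b j⁆ = ∑ l, b.repr X l • ⁅b l, b j⁆ := by
      conv_lhs => rw [← b.sum_repr X]
      simp only [sum_lie, smul_lie]
    have e0 : ⁅X, b 0⁆ = b.repr X 5 • b 0 - (2 * b.repr X 1) • b 3 := by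
      rw [hX, Fin.sum_univ_six, hskew 1 0, h12, hZ1, lie_self, hYY 2 0, hYY 3 0, hYY 4 0] <;>
        first | decide | module
    have e1 : ⁅X, b 1⁆ = (2 * b.repr X 5) • b 1 + (2 * b.repr X 0) • b 3 := by
      rw [hX, Fin.sum_univ_six, h12, hZ2, lie_self, hYY 2 1, hYY 3 1, hYY 4 1] <;>
        first | decide | module
    have e2 : ⁅X, b 2⁆ = (3 * b.repr X 5) • b 2 := by
      rw [hX, Fin.sum_univ_six, hZ3, lie_self, hYY 0 2, hYY 1 2, hYY 3 2, hYY 4 2] <;>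
        first | decide | module
    have e3 : ⁅X, b 3⁆ = (3 * b.repr X 5) • b 3 := by
      rw [hX, Fin.sum_univ_six, hZ4, lie_self, hYY 0 3, hYY 1 3, hYY 2 3, hYY 4 3] <;>
        first | decide | module
    have e4 : ⁅X, b 4⁆ = (4 * b.repr X 5) • b 4 := by
      rw [hX, Fin.sum_univ_six, hZ5, lie_self, hYY 0 4, hYY 1 4, hYY 2 4, hYY 3 4] <;>
        first | decide | module
    have e5 : ⁅X, b 5⁆ = -(b.repr X 0 • b 0 + (2 * b.repr X 1) • b 1 + (3 * b.repr X 2) • b 2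
        + (3 * b.repr X 3) • b 3 + (4 * b.repr X 4) • b 4) := by
      rw [hX, Fin.sum_univ_six, lie_self, hskew 0 5, hskew 1 5, hskew 2 5, hskew 3 5, hskew 4 5,
        hZ1, hZ2, hZ3, hZ4, hZ5]
      module
    have hf : Function.Injective (![1, 2, 3, 0, 4, 5] : Fin 6 → ℕ) := by decide
    have hM : (LinearMap.toMatrix b b (LieAlgebra.ad ℂ g₀ X)).BlockTriangular
        (![1, 2, 3, 0, 4, 5] : Fin 6 → ℕ) := by
      intro i j hij
      rw [LinearMap.toMatrix_apply, LieAlgebra.ad_apply]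
      fin_cases j <;> fin_cases i <;> simp at hij <;>
        simp [e0, e1, e2, e3, e4]
    rw [LinearMap.trace_eq_matrix_trace ℂ b, ← LinearMap.toMatrix_pow, Matrix.trace]
    simp only [Matrix.diag_apply, (blockTriangular_pow_apply_self hf hM k).2,
      LinearMap.toMatrix_apply, LieAlgebra.ad_apply, Fin.sum_univ_six, e0, e1, e2, e3, e4, e5]
    simp [mul_pow, hk.ne']
    ring
  refine ⟨fun k hk _ a => ?_, fun k _ hk =>
    ⟨(1 + (-1) ^ k) * (1 + 2 ^ k + 3 ^ k + 3 ^ k + 4 ^ k), fun a => ?_⟩⟩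
  · rw [trace_adDouble_pow, hk.neg_one_pow]
    ring
  · rw [trace_adDouble_pow, htr _ k hk]
    ring
end
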